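/- Let T be a two-column rank-one cutting-and-stacking transformation of (X,μ) with heights h_j and spacers s_j(2) satisfying s_j(2)/h_j → ∞, and let n ≥ 2 be an integer. Then the product T×T^n is a dissipative transformation of (X×X, μ×μ): there is a measurable set D ⊆ X×X such that the sets (T×T^n)^iD, i∈ℤ, are pairwise disjoint and their union is conull. -/

import Mathlib

open MeasureTheory Filter Topology Set
open scoped ENNReal symmDiff

/-- The two-column rank-one cutting-and-stacking construction: at stage `j`
there is a tower `E_j, TE_j, …, T^{h_j-1}E_j` of pairwise disjoint levels; the
tower is cut in two, with no spacers over the first column and `s j` spacers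
over the second, so `E_j = E_{j+1} ⊔ T^{h_j}E_{j+1}`, `μ(E_{j+1}) = μ(E_j)/2`
and `h_{j+1} = 2h_j + s j`; the levels cover `X` up to a null set, every set of
finite measure is approximated by unions of levels, and `μ(X) = ∞`. -/
structure TwoColumnCutStack {X : Type*} [MeasurableSpace X] (μ : Measure X)
    (T : Equiv.Perm X) (E : ℕ → Set X) (h : ℕ → ℕ) (s : ℕ → ℕ) : Prop where
  measT : Measurable (⇑T)
  measTsymm : Measurable (⇑T.symm)
  mp : MeasurePreserving ⇑T μ μ
  infiniteMeasure : μ Set.univ = ∞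
  measE : ∀ j, MeasurableSet (E j)
  hpos : ∀ j, 0 < h j
  disjLevels : ∀ j, ∀ i i' : ℕ, i < h j → i' < h j → i ≠ i' →
    Disjoint ((⇑(T ^ (i : ℤ))) '' E j) ((⇑(T ^ (i' : ℤ))) '' E j)
  cut : ∀ j, E j = E (j + 1) ∪ (⇑(T ^ (h j : ℤ))) '' E (j + 1)
  cutDisj : ∀ j, Disjoint (E (j + 1)) ((⇑(T ^ (h j : ℤ))) '' E (j + 1))
  half : ∀ j, μ (E (j + 1)) = μ (E j) / 2
  height : ∀ j, h (j + 1) = 2 * h j + s j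
  cover : μ ((⋃ j, ⋃ i ∈ Finset.range (h j), (⇑(T ^ (i : ℤ))) '' E j)ᶜ) = 0
  approx : ∀ A : Set X, MeasurableSet A → μ A < ∞ → ∀ ε : ℝ≥0∞, 0 < ε →
    ∀ᶠ j in atTop, ∃ I : Finset ℕ, (∀ i ∈ I, i < h j) ∧
      μ (symmDiff A (⋃ i ∈ I, (⇑(T ^ (i : ℤ))) '' E j)) < ε
  spacerGrowth : Tendsto (fun j => (s j : ℝ) / (h j : ℝ)) atTop atTop


/-- A set `D` built from the last visits of orbits to the first set `A j` they meet is wandering. -/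
theorem exists_wandering_of_bounded_returns {Y : Type*} [MeasurableSpace Y] (S : Equiv.Perm Y)
    (hS : ∀ k : ℤ, Measurable ⇑(S ^ k)) (A : ℕ → Set Y) (hA : ∀ j, MeasurableSet (A j))
    (hK : ∀ j, ∃ K : ℤ, ∀ z ∈ A j, ∀ k : ℤ, K ≤ k → (S ^ k) z ∉ A j) :
    ∃ D : Set Y, MeasurableSet D ∧
      (∀ i i' : ℤ, i ≠ i' → Disjoint (⇑(S ^ i) '' D) (⇑(S ^ i') '' D)) ∧
      ⋃ j, A j ⊆ ⋃ i : ℤ, ⇑(S ^ i) '' D := by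
  classical
  let D : Set Y := ⋃ j, A j ∩ ((⋂ i, ⋂ (_ : i < j), ⋂ k : ℤ, ⇑(S ^ k) ⁻¹' (A i)ᶜ) ∩
    ⋂ k : ℤ, ⋂ (_ : 0 < k), ⇑(S ^ k) ⁻¹' (A j)ᶜ)
  have mem_D : ∀ z, z ∈ D ↔ ∃ j, z ∈ A j ∧ (∀ i < j, ∀ k : ℤ, (S ^ k) z ∉ A i) ∧
      ∀ k : ℤ, 0 < k → (S ^ k) z ∉ A j := by
    intro z
    simp only [D, mem_iUnion, mem_inter_iff, mem_iInter, mem_preimage, mem_compl_iff]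
  have wandering : ∀ z ∈ D, ∀ k : ℤ, 0 < k → (S ^ k) z ∉ D := by
    intro z hz k hk hz'
    obtain ⟨j, hj, hlt, hlast⟩ := (mem_D z).1 hz
    obtain ⟨j', hj', hlt', -⟩ := (mem_D _).1 hz'
    rcases lt_trichotomy j j' with h | rfl | h
    · refine hlt' j h (-k) ?_
      rwa [← Equiv.Perm.mul_apply, ← zpow_add, neg_add_cancel, zpow_zero, Equiv.Perm.one_apply]
    · exact hlast k hk hj'
    · exact hlt j' h k hj'
  refine ⟨D, ?_, ?_, ?_⟩
  · refine .iUnion fun j => (hA j).inter (.inter ?_ ?_)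
    · exact .iInter fun i => .iInter fun _ => .iInter fun k => hS k (hA i).compl
    · exact .iInter fun k => .iInter fun _ => hS k (hA j).compl
  · have aux : ∀ i i' : ℤ, i < i' → Disjoint (⇑(S ^ i) '' D) (⇑(S ^ i') '' D) := by
      intro i i' hlt
      rw [Set.disjoint_left]
      rintro _ ⟨z, hz, rfl⟩ ⟨w, hw, hwz⟩
      refine wandering w hw (i' - i) (by omega) ?_
      have : (S ^ (i' - i)) w = z := by
        rw [sub_eq_neg_add, zpow_add, Equiv.Perm.mul_apply, hwz, ← Equiv.Perm.mul_apply,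
          ← zpow_add, neg_add_cancel, zpow_zero, Equiv.Perm.one_apply]
      rwa [this]
    intro i i' hne
    rcases hne.lt_or_gt with h | h
    · exact aux _ _ h
    · exact (aux _ _ h).symm
  · intro z hz
    have hex : ∃ j, ∃ k : ℤ, (S ^ k) z ∈ A j := by
      obtain ⟨j, hj⟩ := mem_iUnion.1 hz
      exact ⟨j, 0, by simpa using hj⟩
    obtain ⟨k₀, hk₀⟩ := Nat.find_spec hex
    have hmin := fun i (hi : i < Nat.find hex) => Nat.find_min hex hi
    set j := Nat.find hex
    obtain ⟨K, hK⟩ := hK j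
    obtain ⟨k₁, hk₁, hmax⟩ := Int.exists_greatest_of_bdd (P := fun k => (S ^ k) z ∈ A j)
      ⟨k₀ + K, fun k hk => by
        by_contra! hlt
        refine hK _ hk₀ (k - k₀) (by omega) ?_
        rwa [← Equiv.Perm.mul_apply, ← zpow_add, sub_add_cancel]⟩ ⟨k₀, hk₀⟩
    refine mem_iUnion.2 ⟨-k₁, (S ^ k₁) z, (mem_D _).2 ⟨j, hk₁, ?_, ?_⟩, ?_⟩
    · intro i hi k hk
      rw [← Equiv.Perm.mul_apply, ← zpow_add] at hk
      exact hmin i hi ⟨_, hk⟩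
    · intro k hk hmem
      rw [← Equiv.Perm.mul_apply, ← zpow_add] at hmem
      have := hmax _ hmem
      omega
    · rw [← Equiv.Perm.mul_apply, ← zpow_add, neg_add_cancel, zpow_zero, Equiv.Perm.one_apply]

theorem prodCongr_zpow_apply {X Y : Type*} (T : Equiv.Perm X) (R : Equiv.Perm Y) (k : ℤ)
    (z : X × Y) :
    ((Equiv.prodCongr T R : Equiv.Perm (X × Y)) ^ k) z = ((T ^ k) z.1, (R ^ k) z.2) := by
  let φ : Equiv.Perm X × Equiv.Perm Y →* Equiv.Perm (X × Y) :=
    { toFun := fun p => Equiv.prodCongr p.1 p.2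
      map_one' := rfl
      map_mul' := fun _ _ => rfl }
  exact congrArg (fun f : Equiv.Perm (X × Y) => f z) (map_zpow φ (T, R) k).symm

theorem measurable_perm_zpow {X : Type*} [MeasurableSpace X] {T : Equiv.Perm X}
    (hT : Measurable ⇑T) (hT' : Measurable ⇑T.symm) (k : ℤ) : Measurable ⇑(T ^ k) := by
  cases k with
  | ofNat m =>
    rw [Int.ofNat_eq_natCast, zpow_natCast, Equiv.Perm.coe_pow]
    exact hT.iterate m
  | negSucc m =>
    rw [zpow_negSucc, ← inv_pow, Equiv.Perm.coe_pow]
    exact hT'.iterate (m + 1)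

theorem no_common_return_time {H : ℕ → ℤ} {C n k : ℤ} {J p q : ℕ} (hn : 2 ≤ n)
    (hC : 2 * n + 16 ≤ C) (hH : ∀ j, 0 < H j) (hmono : Monotone H)
    (hratio : ∀ i, J ≤ i → C * H i ≤ H (i + 1)) (hp : J ≤ p) (hq : J ≤ q)
    (hkp : |k - H (p + 1)| < 2 * H p) (hkq : |n * k - H (q + 1)| < 2 * H q) : False := by
  rw [abs_lt] at hkp hkq
  have hrp := hratio p hp
  have hrq := hratio q hq
  have hp0 := hH p
  have hq0 := hH q
  have h1 : (2 * n + 16) * H p ≤ C * H p := by gcongr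
  have h2 : (2 * n + 16) * H q ≤ C * H q := by gcongr
  have h3 : 2 * H p ≤ n * H p := by gcongr
  have hk : 0 < k := by linarith
  have h4 : 2 * k ≤ n * k := by gcongr
  rcases lt_trichotomy q p with h | rfl | h
  · have := hmono (show q + 1 ≤ p from h)
    have := hmono h.le
    linarith
  · linarith
  · have h5 := hmono (show p + 1 ≤ q from h)
    have h6 : n * k ≤ n * (2 * H (p + 1)) := by
      gcongr
      linarith
    have h7 : n * H (p + 1) ≤ n * H q := by gcongr
    linarith

namespace TwoColumnCutStack

/-- The union of the levels of the stage-`j` tower. -/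
def tower {X : Type*} (T : Equiv.Perm X) (E : ℕ → Set X) (h : ℕ → ℕ) (j : ℕ) : Set X :=
  ⋃ i ∈ Finset.range (h j), ⇑(T ^ (i : ℤ)) '' E j

theorem mem_tower {X : Type*} {T : Equiv.Perm X} {E : ℕ → Set X} {h : ℕ → ℕ} {j : ℕ} {x : X} :
    x ∈ tower T E h j ↔ ∃ a : ℤ, 0 ≤ a ∧ a < h j ∧ (T ^ (-a)) x ∈ E j := by
  simp only [tower, mem_iUnion, Finset.mem_range, exists_prop]
  constructor
  · rintro ⟨i, hi, y, hy, rfl⟩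
    refine ⟨i, by omega, by omega, ?_⟩
    rwa [← Equiv.Perm.mul_apply, ← zpow_add, neg_add_cancel, zpow_zero, Equiv.Perm.one_apply]
  · rintro ⟨a, ha, hlt, hx⟩
    refine ⟨a.toNat, by omega, _, hx, ?_⟩
    rw [Int.toNat_of_nonneg ha, ← Equiv.Perm.mul_apply, ← zpow_add, add_neg_cancel, zpow_zero,
      Equiv.Perm.one_apply]

variable {X : Type*} [MeasurableSpace X] {μ : Measure X} {T : Equiv.Perm X} {E : ℕ → Set X}
  {h s : ℕ → ℕ}

theorem two_mul_height_le (hT : TwoColumnCutStack μ T E h s) (j : ℕ) : 2 * h j ≤ h (j + 1) := by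
  rw [hT.height]
  omega

theorem height_strictMono (hT : TwoColumnCutStack μ T E h s) : StrictMono h :=
  strictMono_nat_of_lt_succ fun j => by
    have := hT.hpos j
    have := hT.two_mul_height_le j
    omega

theorem mem_or_mem_of_cut (hT : TwoColumnCutStack μ T E h s) {j : ℕ} {a : ℤ} {x : X}
    (hx : (T ^ (-a)) x ∈ E j) :
    (T ^ (-a)) x ∈ E (j + 1) ∨ (T ^ (-(a + h j))) x ∈ E (j + 1) := by
  rw [hT.cut j] at hx
  refine hx.imp id ?_
  rintro ⟨y, hy, hyx⟩
  rwa [neg_add_rev, zpow_add, Equiv.Perm.mul_apply, ← hyx, ← Equiv.Perm.mul_apply, ← zpow_add,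
    neg_add_cancel, zpow_zero, Equiv.Perm.one_apply]

theorem position_unique (hT : TwoColumnCutStack μ T E h s) {j : ℕ} {a b : ℤ} {x : X}
    (ha : (T ^ (-a)) x ∈ E j) (hb : (T ^ (-b)) x ∈ E j) (hab : |a - b| < h j) : a = b := by
  wlog hle : a ≤ b generalizing a b
  · exact (this hb ha (by rwa [abs_sub_comm]) (le_of_not_ge hle)).symm
  by_contra hne
  rw [abs_lt] at hab
  have hdisj := hT.disjLevels j 0 (b - a).toNat (hT.hpos j) (by omega) (by omega)
  refine Set.disjoint_left.1 hdisj ⟨_, ha, rfl⟩ ⟨_, hb, ?_⟩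
  rw [Int.toNat_of_nonneg (by omega), ← Equiv.Perm.mul_apply, ← Equiv.Perm.mul_apply,
    ← zpow_add, ← zpow_add]
  congr 2
  simp only [Nat.cast_zero]
  abel

theorem measurableSet_tower (hT : TwoColumnCutStack μ T E h s) (j : ℕ) :
    MeasurableSet (tower T E h j) := by
  refine Finset.measurableSet_biUnion _ fun i _ => ?_
  rw [Equiv.image_eq_preimage_symm]
  have : ⇑(T ^ (i : ℤ)).symm = ⇑(T ^ (-(i : ℤ))) := by rw [zpow_neg]; rfl
  rw [this]
  exact measurable_perm_zpow hT.measT hT.measTsymm _ (hT.measE j)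

/-- A point of the stage-`j` tower sits in the first two copies of that tower inside the next. -/
theorem exists_position_succ (hT : TwoColumnCutStack μ T E h s) {j : ℕ} {x : X}
    (hx : x ∈ tower T E h j) :
    ∃ a : ℤ, 0 ≤ a ∧ a < 2 * h j ∧ (T ^ (-a)) x ∈ E (j + 1) := by
  obtain ⟨a, ha, hlt, hx⟩ := mem_tower.1 hx
  rcases hT.mem_or_mem_of_cut hx with hx | hx
  · exact ⟨a, ha, by omega, hx⟩
  · exact ⟨a + h j, by omega, by omega, hx⟩

theorem tower_mono (hT : TwoColumnCutStack μ T E h s) : Monotone (tower T E h) := by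
  refine monotone_nat_of_le_succ fun j x hx => ?_
  obtain ⟨a, ha, hlt, hx⟩ := hT.exists_position_succ hx
  have := hT.two_mul_height_le j
  exact mem_tower.2 ⟨a, ha, by omega, hx⟩

/-- Long return times to a tower are close to a height of the construction. -/
theorem return_time_near_height (hT : TwoColumnCutStack μ T E h s) {J : ℕ}
    (hratio : ∀ i, J ≤ i → 16 * h i ≤ h (i + 1)) {x : X} {k : ℤ} (hx : x ∈ tower T E h J)
    (hkx : (T ^ k) x ∈ tower T E h J) (hk : h (J + 1) ≤ k) :
    ∃ p, J ≤ p ∧ |k - h (p + 1)| < 2 * (h p : ℤ) := by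
  have hex : ∃ p, 2 * k < h p :=
    ⟨(2 * k).toNat + 1, by have := hT.height_strictMono.le_apply (x := (2 * k).toNat + 1); omega⟩
  classical
  obtain ⟨m, hm⟩ : ∃ m, Nat.find hex = J + m + 2 := by
    have hlt : J + 1 < Nat.find hex := by
      rw [Nat.lt_find_iff]
      intro i hi
      have := hT.height_strictMono.monotone hi
      omega
    exact ⟨Nat.find hex - (J + 2), by omega⟩
  have hupper := Nat.find_spec hex
  have hlower := Nat.find_min hex (show J + m + 1 < Nat.find hex by omega)
  rw [hm] at hupper
  refine ⟨J + m, by omega, ?_⟩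
  have hr₀ := hratio (J + m) (by omega)
  have hr₁ : 16 * h (J + m + 1) ≤ h (J + m + 2) := hratio (J + m + 1) (by omega)
  have hpos := hT.hpos (J + m)
  obtain ⟨a, ha, halt, hxa⟩ := hT.exists_position_succ (hT.tower_mono (Nat.le_add_right J m) hx)
  obtain ⟨b, hb, hblt, hxb⟩ := hT.exists_position_succ (hT.tower_mono (Nat.le_add_right J m) hkx)
  have key : ∀ c d : ℤ, (T ^ (-c)) x ∈ E (J + m + 2) → (T ^ (-d)) ((T ^ k) x) ∈ E (J + m + 2) →
      0 ≤ c → 0 ≤ d → c < 2 * h (J + m) + h (J + m + 1) → d < 2 * h (J + m) + h (J + m + 1) →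
      c = d - k := by
    intro c d hc hd hc0 hd0 hc1 hd1
    rw [← Equiv.Perm.mul_apply, ← zpow_add] at hd
    refine hT.position_unique hc (by rwa [neg_sub, sub_eq_neg_add]) ?_
    rw [abs_lt]
    constructor <;> omega
  rw [abs_lt]
  rcases hT.mem_or_mem_of_cut hxa with hc | hc <;> rcases hT.mem_or_mem_of_cut hxb with hd | hd <;>
    have := key _ _ hc hd (by omega) (by omega) (by omega) (by omega) <;>
    constructor <;> omega

theorem eventually_mul_height_le (hT : TwoColumnCutStack μ T E h s) (C : ℤ) :
    ∀ᶠ j in atTop, C * h j ≤ h (j + 1) := by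
  filter_upwards [hT.spacerGrowth.eventually_ge_atTop (C : ℝ)] with j hj
  have hpos : (0 : ℝ) < h j := by exact_mod_cast hT.hpos j
  rw [le_div_iff₀ hpos] at hj
  have hj' : C * h j ≤ s j := by exact_mod_cast hj
  have := hT.height j
  omega

theorem prod_returns_bounded (hT : TwoColumnCutStack μ T E h s) {n : ℤ} (hn : 2 ≤ n) {J : ℕ}
    (hratio : ∀ i, J ≤ i → (2 * n + 16) * h i ≤ h (i + 1)) {x y : X} {k : ℤ}
    (hx : x ∈ tower T E h J) (hkx : (T ^ k) x ∈ tower T E h J) (hy : y ∈ tower T E h J)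
    (hky : (T ^ (n * k)) y ∈ tower T E h J) : k < h (J + 1) := by
  by_contra! hk
  have hratio' : ∀ i, J ≤ i → 16 * h i ≤ h (i + 1) := by
    intro i hi
    have h1 := hratio i hi
    have h2 : (16 : ℤ) * h i ≤ (2 * n + 16) * h i := by gcongr; omega
    omega
  obtain ⟨p, hp, hkp⟩ := hT.return_time_near_height hratio' hx hkx hk
  obtain ⟨q, hq, hkq⟩ := hT.return_time_near_height hratio' hy hky (by nlinarith)
  exact no_common_return_time (H := fun i => (h i : ℤ)) hn le_rfl
    (fun j => by exact_mod_cast hT.hpos j)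
    (fun i j hij => Nat.cast_le.2 (hT.height_strictMono.monotone hij)) hratio hp hq hkp hkq

end TwoColumnCutStack


/-- For a two-column rank-one construction `T` with `s_j(2)/h_j → ∞` and any
integer `n ≥ 2`, the product `T × T^n` is dissipative: some measurable
`D ⊆ X × X` has pairwise disjoint images under all integer powers of
`T × T^n`, with conull union. -/
theorem product_with_power_dissipative
    {X : Type*} [MeasurableSpace X] (μ : Measure X) [SigmaFinite μ]
    (T : Equiv.Perm X) (E : ℕ → Set X) (h : ℕ → ℕ) (s : ℕ → ℕ)
    (hT : TwoColumnCutStack μ T E h s)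
    (n : ℤ) (hn : 2 ≤ n) :
    ∃ D : Set (X × X), MeasurableSet D ∧
      (∀ i i' : ℤ, i ≠ i' →
        Disjoint ((⇑((Equiv.prodCongr T (T ^ n)) ^ i)) '' D)
          ((⇑((Equiv.prodCongr T (T ^ n)) ^ i')) '' D)) ∧
      (μ.prod μ) ((⋃ i : ℤ, (⇑((Equiv.prodCongr T (T ^ n)) ^ i)) '' D)ᶜ) = 0 := by
  obtain ⟨J, hJ⟩ := eventually_atTop.1 (hT.eventually_mul_height_le (2 * n + 16))
  have hmeas := measurable_perm_zpow hT.measT hT.measTsymm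
  let U : ℕ → Set X := fun j => TwoColumnCutStack.tower T E h (J + j)
  have hU : ∀ j, MeasurableSet (U j) := fun j => hT.measurableSet_tower _
  have hS : ∀ k : ℤ, Measurable ⇑((Equiv.prodCongr T (T ^ n) : Equiv.Perm (X × X)) ^ k) := by
    intro k
    have : ⇑((Equiv.prodCongr T (T ^ n) : Equiv.Perm (X × X)) ^ k) =
        fun z => ((T ^ k) z.1, (T ^ (n * k)) z.2) := by
      ext1 z
      rw [prodCongr_zpow_apply, zpow_mul]
    rw [this]
    exact ((hmeas _).comp measurable_fst).prodMk ((hmeas _).comp measurable_snd)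
  have hK : ∀ j, ∃ K : ℤ, ∀ z ∈ U j ×ˢ U j, ∀ k : ℤ, K ≤ k →
      ((Equiv.prodCongr T (T ^ n) : Equiv.Perm (X × X)) ^ k) z ∉ U j ×ˢ U j := by
    intro j
    refine ⟨h (J + j + 1), ?_⟩
    rintro ⟨x, y⟩ ⟨hx, hy⟩ k hk hmem
    rw [prodCongr_zpow_apply, ← zpow_mul] at hmem
    have := hT.prod_returns_bounded hn (fun i hi => hJ i (by omega)) hx hmem.1 hy hmem.2
    omega
  obtain ⟨D, hD, hdisj, hcover⟩ := exists_wandering_of_bounded_returns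
    (Equiv.prodCongr T (T ^ n)) hS (fun j => U j ×ˢ U j) (fun j => (hU j).prod (hU j)) hK
  refine ⟨D, hD, hdisj, measure_mono_null (compl_subset_compl.2 hcover) ?_⟩
  have hnull : μ (⋃ j, U j)ᶜ = 0 := by
    refine measure_mono_null (compl_subset_compl.2 (iUnion_subset fun j => ?_)) hT.cover
    exact (hT.tower_mono (Nat.le_add_left j J)).trans (subset_iUnion U j)
  have hmono : Monotone U := fun i j hij => hT.tower_mono (Nat.add_le_add_left hij J)
  rw [iUnion_prod_of_monotone hmono hmono, compl_prod_eq_union]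
  refine measure_union_null ?_ ?_ <;> rw [Measure.prod_prod, hnull] <;> simp
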